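/- For the 1-d periodic fractional Schrödinger propagator e^{it(−Δ)^α} with α ∈ (1/2, 1), defined on Fourier side by multiplication with e^{it|n|^{2α}}, the Strichartz estimate ‖e^{it(−Δ)^α} f‖_{L⁴_{t∈𝕋} L⁴_{x∈𝕋}} ≤ C_s ‖f‖_{H^s(𝕋)} holds for every s > (1−α)/4. -/

import Mathlib

open Real MeasureTheory

/-- Japanese bracket of an integer. -/
noncomputable def jb (m : ℤ) : ℝ := Real.sqrt (1 + (m : ℝ) ^ 2)

/-- The solution of the linear fractional Schrödinger equation `e^{it(-Δ)^α} f`,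
where `f` has Fourier coefficients `a : ℤ → ℂ`. -/
noncomputable def fracProp (α : ℝ) (a : ℤ → ℂ) (t x : ℝ) : ℂ :=
  ∑' n : ℤ, a n * Complex.exp (Complex.I * ((t * (|n| : ℝ) ^ (2 * α) + (n : ℝ) * x : ℝ) : ℂ))

/-- Concavity of `z ↦ z ^ p`, in a form that is uniform in the sign of the smaller point. -/
lemma half_mul_rpow_mul_sub_le {p x y : ℝ} (hp : 0 < p) (hp1 : p ≤ 1) (hx : 0 < x) (hy : |y| ≤ x) :
    p / 2 * (x ^ (p - 1) * (x - y)) ≤ x ^ (p - 1) * x - |y| ^ (p - 1) * y := by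
  have hxp : 0 < x ^ (p - 1) := rpow_pos_of_pos hx _
  obtain ⟨hy1, hy2⟩ := abs_le.1 hy
  rcases le_or_gt y 0 with h | h
  · have h1 : 0 ≤ |y| ^ (p - 1) * (-y) := by
      have := rpow_nonneg (abs_nonneg y) (p - 1)
      exact mul_nonneg this (by linarith)
    have h2 : p / 2 * (x - y) ≤ x := by nlinarith
    have h3 := mul_le_mul_of_nonneg_left h2 hxp.le
    nlinarith
  · rw [abs_of_pos h]
    have h1 : y ^ (p - 1) * y = y ^ p := by
      rw [rpow_sub_one h.ne']; field_simp
    have h2 := rpow_one_add_le_one_add_mul_self (s := y / x - 1)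
      (by linarith [div_nonneg h.le hx.le]) hp.le hp1
    rw [add_sub_cancel, div_rpow h.le hx.le, div_le_iff₀ (rpow_pos_of_pos hx _)] at h2
    have h3 : x ^ p = x ^ (p - 1) * x := by
      rw [rpow_sub_one hx.ne']; field_simp
    rw [h1]
    rw [h3] at h2
    have h4 : (1 + p * (y / x - 1)) * (x ^ (p - 1) * x) =
        x ^ (p - 1) * x - p * (x ^ (p - 1) * (x - y)) := by
      field_simp; ring
    rw [h4] at h2
    have h5 : 0 ≤ p * (x ^ (p - 1) * (x - y)) :=
      mul_nonneg hp.le (mul_nonneg hxp.le (by linarith))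
    linarith

/-- The sum of the dispersion relations of two frequencies `x` and `k - x`. -/
noncomputable def pairPhase (α k x : ℝ) : ℝ := |x| ^ (2 * α) + |k - x| ^ (2 * α)

lemma pairPhase_sub_ge {α k x y : ℝ} (hα : 1 / 2 < α) (hα1 : α < 1) (hk : 0 ≤ k)
    (hy : k ≤ 2 * y) (hxy : y ≤ x) :
    α * (2 * α - 1) * (x ^ (2 * α - 2) * ((x - y) * (x + y - k))) ≤
      pairPhase α k x - pairPhase α k y := by
  set c := α * (2 * α - 1) * x ^ (2 * α - 2) with hc
  have hd : ∀ z : ℝ, HasDerivAt (fun z => pairPhase α k z - c * (z ^ 2 - k * z))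
      ((2 * α) * |z| ^ (2 * α - 2) * z - (2 * α) * |k - z| ^ (2 * α - 2) * (k - z)
        - c * (2 * z - k)) z := by
    intro z
    have h1 := hasDerivAt_abs_rpow z (p := 2 * α) (by linarith)
    have h2 := (hasDerivAt_abs_rpow (k - z) (p := 2 * α) (by linarith)).comp z
      ((hasDerivAt_id z).const_sub k)
    have h3 := (((hasDerivAt_id z).pow 2).sub ((hasDerivAt_id z).const_mul k)).const_mul c
    refine ((h1.add h2).sub h3).congr_deriv ?_
    simp only [id_eq]
    push_cast
    ring
  have hmono : MonotoneOn (fun z => pairPhase α k z - c * (z ^ 2 - k * z)) (Set.Icc y x) := by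
    refine monotoneOn_of_deriv_nonneg (convex_Icc _ _)
      (fun z _ => (hd z).continuousAt.continuousWithinAt)
      (fun z _ => (hd z).differentiableAt.differentiableWithinAt) ?_
    intro z hz
    rw [interior_Icc] at hz
    rw [(hd z).deriv]
    have hz0 : 0 < z := by linarith [hz.1]
    have h1 := half_mul_rpow_mul_sub_le (p := 2 * α - 1) (x := z) (y := k - z)
      (by linarith) (by linarith) hz0 (abs_le.2 ⟨by linarith, by linarith [hz.1]⟩)
    rw [show 2 * α - 1 - 1 = 2 * α - 2 by ring] at h1
    rw [abs_of_pos hz0]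
    have h2 : x ^ (2 * α - 2) ≤ z ^ (2 * α - 2) :=
      rpow_le_rpow_of_nonpos hz0 hz.2.le (by linarith)
    have h3 : c * (2 * z - k) ≤ α * (2 * α - 1) * z ^ (2 * α - 2) * (2 * z - k) := by
      have h4 : 0 ≤ α * (2 * α - 1) := mul_nonneg (by linarith) (by linarith)
      have h5 : 0 ≤ 2 * z - k := by linarith [hz.1]
      rw [hc]
      gcongr
    have h6 := mul_le_mul_of_nonneg_left h1 (show 0 ≤ 2 * α by linarith)
    linarith
  have := hmono (Set.left_mem_Icc.2 hxy) (Set.right_mem_Icc.2 hxy) hxy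
  simp only at this
  rw [hc] at this
  linarith

lemma one_le_jb (m : ℤ) : 1 ≤ jb m := by
  rw [jb]
  exact Real.one_le_sqrt.2 (by nlinarith [sq_nonneg (m : ℝ)])

lemma abs_le_jb (m : ℤ) : |(m : ℝ)| ≤ jb m := by
  rw [jb]
  exact Real.abs_le_sqrt (by linarith)

lemma jb_neg (m : ℤ) : jb (-m) = jb m := by simp [jb]

lemma sq_sub_le_of_two_mul_ge {α : ℝ} (hα : 1 / 2 < α) (hα1 : α < 1) :
    ∃ C > 0, ∀ k m n : ℤ, 0 ≤ k → k ≤ 2 * m → k ≤ 2 * n →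
      ((m : ℝ) - n) ^ 2 ≤ C * ((1 + (pairPhase α k m - pairPhase α k n) ^ 2) *
        (jb m * jb (k - m)) ^ (1 - α)) := by
  have hc : 0 < α * (2 * α - 1) := mul_pos (by linarith) (by linarith)
  set c := α * (2 * α - 1) with hcdef
  refine ⟨(8 / c) ^ 2 + 4 / c, by positivity, ?_⟩
  intro k m n hk hm hn
  have hL : 1 ≤ jb m * jb (k - m) := one_le_mul_of_one_le_of_one_le (one_le_jb _) (one_le_jb _)
  have hLg : 1 ≤ (jb m * jb (k - m)) ^ (1 - α) := one_le_rpow hL (by linarith)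
  set D := pairPhase α k m - pairPhase α k n with hD
  rcases eq_or_ne m n with rfl | hne
  · simp only [sub_self, ne_eq, OfNat.ofNat_ne_zero, not_false_eq_true, zero_pow]
    positivity
  set M : ℝ := max (m : ℝ) n with hM
  set d : ℝ := |(m : ℝ) - n| with hd
  set e : ℝ := (m : ℝ) + n - k with he
  have hk' : (0 : ℝ) ≤ k := by exact_mod_cast hk
  have hm' : (k : ℝ) ≤ 2 * m := by exact_mod_cast hm
  have hn' : (k : ℝ) ≤ 2 * n := by exact_mod_cast hn
  have hM1 : 1 ≤ M := by
    have : 1 ≤ max m n := by omega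
    rw [hM]; exact_mod_cast this
  have hde : d ≤ e := abs_le.2 ⟨by linarith, by linarith⟩
  have hd0 : 0 ≤ d := abs_nonneg _
  have hgap : c * (M ^ (2 * α - 2) * (d * e)) ≤ |D| := by
    rcases le_total n m with h | h
    · have h' : (n : ℝ) ≤ m := by exact_mod_cast h
      rw [hM, max_eq_left h', hd, abs_of_nonneg (by linarith)]
      exact (pairPhase_sub_ge hα hα1 hk' hn' h').trans (le_abs_self _)
    · have h' : (m : ℝ) ≤ n := by exact_mod_cast h
      rw [hM, max_eq_right h', hd, abs_sub_comm, abs_of_nonneg (by linarith), he, hD,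
        abs_sub_comm, add_comm (m : ℝ)]
      exact (pairPhase_sub_ge hα hα1 hk' hm' h').trans (le_abs_self _)
  rw [← sq_abs, ← hd]
  rcases le_or_gt (M / 8) e with h | h
  · have h1 : 1 ≤ M ^ (2 * α - 2) * M := by
      rw [← rpow_add_one (by positivity)]
      exact one_le_rpow hM1 (by linarith)
    have h2 : c / 8 * d ≤ |D| := by
      refine le_trans ?_ hgap
      have : M ^ (2 * α - 2) * (d * (M / 8)) ≤ M ^ (2 * α - 2) * (d * e) := by gcongr
      have h3 : d * 1 ≤ d * (M ^ (2 * α - 2) * M) := by gcongr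
      have h4 := mul_le_mul_of_nonneg_left this hc.le
      have h5 := mul_le_mul_of_nonneg_left h3 hc.le
      nlinarith
    have h3 : d ≤ 8 / c * |D| := by
      rw [div_mul_eq_mul_div, le_div_iff₀ hc]; linarith
    calc d ^ 2 ≤ (8 / c * |D|) ^ 2 := by gcongr
      _ = (8 / c) ^ 2 * (D ^ 2 * 1) := by rw [mul_pow, sq_abs]; ring
      _ ≤ ((8 / c) ^ 2 + 4 / c) * ((1 + D ^ 2) * (jb m * jb (k - m)) ^ (1 - α)) := by
        gcongr
        · linarith [show 0 < 4 / c by positivity]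
        · linarith
  · have hmM : M ≤ m + d := by
      rw [hM, hd]
      exact max_le (by linarith [abs_nonneg ((m : ℝ) - n)]) (by linarith [neg_abs_le ((m : ℝ) - n)])
    have hnM : M ≤ n + d := by
      rw [hM, hd]
      exact max_le (by linarith [le_abs_self ((m : ℝ) - n)]) (by linarith [abs_nonneg ((m : ℝ) - n)])
    have h1 : M / 2 ≤ jb m :=
      le_trans (by linarith) ((le_abs_self _).trans (abs_le_jb m))
    have h2 : M / 2 ≤ jb (k - m) := by
      refine le_trans ?_ ((le_abs_self _).trans (abs_le_jb _))
      push_cast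
      linarith
    have h3 : M ^ (2 - 2 * α) / 4 ≤ (jb m * jb (k - m)) ^ (1 - α) := by
      calc M ^ (2 - 2 * α) / 4 ≤ M ^ (2 - 2 * α) / 4 ^ (1 - α) := by
            gcongr
            calc (4 : ℝ) ^ (1 - α) ≤ 4 ^ (1 : ℝ) :=
                  rpow_le_rpow_of_exponent_le (by norm_num) (by linarith)
              _ = 4 := rpow_one _
        _ = (M / 2 * (M / 2)) ^ (1 - α) := by
            rw [show M / 2 * (M / 2) = M ^ (2 : ℝ) / 4 by rw [rpow_two]; ring,
              div_rpow (by positivity) (by norm_num), ← rpow_mul (by positivity)]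
            ring_nf
        _ ≤ _ := by
            apply rpow_le_rpow (by positivity) _ (by linarith)
            gcongr
            linarith [one_le_jb m]
    have h4 : M ^ (2 * α - 2) * M ^ (2 - 2 * α) = 1 := by
      rw [← rpow_add (by positivity)]; simp
    have h5 : c * (M ^ (2 * α - 2) * d ^ 2) ≤ 1 + D ^ 2 := by
      calc c * (M ^ (2 * α - 2) * d ^ 2) ≤ c * (M ^ (2 * α - 2) * (d * e)) := by
            rw [sq]; gcongr
        _ ≤ |D| := hgap
        _ ≤ 1 + D ^ 2 := by nlinarith [sq_abs D, sq_nonneg (|D| - 1), abs_nonneg D]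
    calc d ^ 2 = 4 / c * ((c * (M ^ (2 * α - 2) * d ^ 2)) * (M ^ (2 - 2 * α) / 4)) := by
          rw [show 4 / c * ((c * (M ^ (2 * α - 2) * d ^ 2)) * (M ^ (2 - 2 * α) / 4)) =
            c / c * ((M ^ (2 * α - 2) * M ^ (2 - 2 * α)) * d ^ 2) by ring, h4, div_self hc.ne']
          ring
      _ ≤ ((8 / c) ^ 2 + 4 / c) * ((1 + D ^ 2) * (jb m * jb (k - m)) ^ (1 - α)) := by
        gcongr
        linarith [show 0 < (8 / c) ^ 2 by positivity]

lemma pairPhase_reflect (α k x : ℝ) : pairPhase α k (k - x) = pairPhase α k x := by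
  simp [pairPhase, add_comm]

lemma pairPhase_neg (α k x : ℝ) : pairPhase α (-k) (-x) = pairPhase α k x := by
  rw [pairPhase, pairPhase, abs_neg, ← abs_neg (-k - -x)]
  ring_nf

lemma min_sq_le {α : ℝ} (hα : 1 / 2 < α) (hα1 : α < 1) :
    ∃ C > 0, ∀ k m n : ℤ,
      (min |(m : ℝ) - n| |(m : ℝ) + n - k|) ^ 2 ≤
        C * ((1 + (pairPhase α k m - pairPhase α k n) ^ 2) * (jb m * jb (k - m)) ^ (1 - α)) := by
  obtain ⟨C, hC, H⟩ := sq_sub_le_of_two_mul_ge hα hα1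
  refine ⟨C, hC, ?_⟩
  have H3 : ∀ k m n : ℤ, 0 ≤ k → k ≤ 2 * m → (min |(m : ℝ) - n| |(m : ℝ) + n - k|) ^ 2 ≤
      C * ((1 + (pairPhase α k m - pairPhase α k n) ^ 2) * (jb m * jb (k - m)) ^ (1 - α)) := by
    intro k m n hk hm
    rcases le_total k (2 * n) with hn | hn
    · refine le_trans ?_ (H k m n hk hm hn)
      rw [← sq_abs ((m : ℝ) - n)]
      gcongr
      exact min_le_left _ _
    · have := H k m (k - n) hk hm (by omega)
      push_cast at this
      rw [pairPhase_reflect] at this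
      refine le_trans ?_ this
      rw [← sq_abs ((m : ℝ) - (k - n)), show (m : ℝ) - (k - n) = m + n - k by ring]
      gcongr
      exact min_le_right _ _
  have H2 : ∀ k m n : ℤ, 0 ≤ k → (min |(m : ℝ) - n| |(m : ℝ) + n - k|) ^ 2 ≤
      C * ((1 + (pairPhase α k m - pairPhase α k n) ^ 2) * (jb m * jb (k - m)) ^ (1 - α)) := by
    intro k m n hk
    rcases le_total k (2 * m) with hm | hm
    · exact H3 k m n hk hm
    · have := H3 k (k - m) n hk (by omega)
      push_cast at this
      rw [pairPhase_reflect, sub_sub_cancel, mul_comm (jb (k - m)), min_comm,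
        show (k : ℝ) - m + n - k = -(m - n) by ring,
        show (k : ℝ) - m - n = -(m + n - k) by ring, abs_neg, abs_neg] at this
      exact this
  intro k m n
  rcases le_total 0 k with hk | hk
  · exact H2 k m n hk
  · have := H2 (-k) (-m) (-n) (by omega)
    push_cast at this
    rw [pairPhase_neg, pairPhase_neg, show -k - -m = -(k - m) by ring, jb_neg, jb_neg,
      show -(m : ℝ) - -n = -(m - n) by ring, show -(m : ℝ) + -n - -k = -(m + n - k) by ring,
      abs_neg, abs_neg] at this
    exact this

lemma summable_one_add_abs_int_rpow {b : ℝ} (hb : 1 < b) :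
    Summable fun n : ℤ => (1 + |(n : ℝ)|) ^ (-b) := by
  have h : Summable fun n : ℕ => (1 + (n : ℝ)) ^ (-b) := by
    have := (Real.summable_one_div_nat_add_rpow 1 b).2 hb
    refine this.congr fun n => ?_
    rw [abs_of_nonneg (by positivity), rpow_neg (by positivity), one_div, add_comm]
  refine Summable.of_nat_of_neg ?_ ?_ <;> simpa using h

lemma sum_resonance_le {α s : ℝ} (hα : 1 / 2 < α) (hα1 : α < 1) (hs : (1 - α) / 4 < s) :
    ∃ C > 0, ∀ (k n : ℤ) (F : Finset ℤ),
      ∑ m ∈ F, (1 + (pairPhase α k n - pairPhase α k m) ^ 2)⁻¹ *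
        (jb m ^ (2 * s) * jb (k - m) ^ (2 * s))⁻¹ ≤ C := by
  obtain ⟨C, hC, H⟩ := min_sq_le hα hα1
  obtain ⟨δ, hδ, hδ1, hδs⟩ : ∃ δ : ℝ, 0 < δ ∧ δ ≤ 1 ∧ (1 - α) * ((1 + δ) / 2) ≤ 2 * s := by
    have h1 : 0 < 1 - α := by linarith
    refine ⟨min 1 (4 * s / (1 - α) - 1), ?_, min_le_left _ _, ?_⟩
    · refine lt_min one_pos ?_
      rw [sub_pos, lt_div_iff₀ h1]; linarith
    · have := min_le_right 1 (4 * s / (1 - α) - 1)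
      have h2 : (1 - α) * (4 * s / (1 - α)) = 4 * s := by field_simp
      nlinarith
  set B : ℝ := (2 + 2 * C) ^ ((1 + δ) / 2) with hB
  have hB0 : 0 < B := by positivity
  have key : ∀ k n m : ℤ, (1 + (pairPhase α k n - pairPhase α k m) ^ 2)⁻¹ *
        (jb m ^ (2 * s) * jb (k - m) ^ (2 * s))⁻¹ ≤
      B * ((1 + |((m - n : ℤ) : ℝ)|) ^ (-(1 + δ)) +
        (1 + |((m + n - k : ℤ) : ℝ)|) ^ (-(1 + δ))) := by
    intro k n m
    have hm := one_le_jb m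
    have hkm := one_le_jb (k - m)
    have hL : 1 ≤ jb m * jb (k - m) := one_le_mul_of_one_le_of_one_le hm hkm
    have hLg : 1 ≤ (jb m * jb (k - m)) ^ (1 - α) := one_le_rpow hL (by linarith)
    have h1 := H k m n
    rw [← sq_abs (pairPhase α k m - _), abs_sub_comm (pairPhase α k m), sq_abs] at h1
    set E := 1 + (pairPhase α k n - pairPhase α k m) ^ 2 with hE
    have hE1 : 1 ≤ E := by rw [hE]; linarith [sq_nonneg (pairPhase α k n - pairPhase α k m)]
    set μ := min |(m : ℝ) - n| |(m : ℝ) + n - k| with hμ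
    have hμ0 : 0 ≤ μ := le_min (abs_nonneg _) (abs_nonneg _)
    have hX : 1 ≤ E * (jb m * jb (k - m)) ^ (1 - α) := one_le_mul_of_one_le_of_one_le hE1 hLg
    have h2 : (1 + μ) ^ 2 ≤ (2 + 2 * C) * (E * (jb m * jb (k - m)) ^ (1 - α)) := by
      nlinarith [sq_nonneg (1 - μ)]
    have h3 : (1 + μ) ^ (1 + δ) ≤ B * (E * (jb m ^ (2 * s) * jb (k - m) ^ (2 * s))) := by
      calc (1 + μ) ^ (1 + δ) = ((1 + μ) ^ 2) ^ ((1 + δ) / 2) := by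
            rw [← rpow_two, ← rpow_mul (by positivity)]; ring_nf
        _ ≤ ((2 + 2 * C) * (E * (jb m * jb (k - m)) ^ (1 - α))) ^ ((1 + δ) / 2) :=
            rpow_le_rpow (by positivity) h2 (by positivity)
        _ = B * (E ^ ((1 + δ) / 2) * (jb m * jb (k - m)) ^ ((1 - α) * ((1 + δ) / 2))) := by
            rw [mul_rpow (by positivity) (by positivity), mul_rpow (by positivity) (by positivity),
              ← rpow_mul (by positivity)]
        _ ≤ B * (E ^ (1 : ℝ) * (jb m * jb (k - m)) ^ (2 * s)) := by
            gcongr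
            · linarith
        _ = _ := by rw [rpow_one, mul_rpow (by positivity) (by positivity)]
    have hjm : 0 < jb m := by linarith
    have hjk : 0 < jb (k - m) := by linarith
    have hE0 : 0 < E := by linarith
    have h4 : E⁻¹ * (jb m ^ (2 * s) * jb (k - m) ^ (2 * s))⁻¹ ≤ B * (1 + μ) ^ (-(1 + δ)) := by
      rw [← mul_inv, rpow_neg (by positivity), inv_le_iff_one_le_mul₀ (by positivity), ← div_eq_mul_inv,
        div_mul_eq_mul_div, le_div_iff₀ (by positivity), one_mul]
      exact h3
    refine h4.trans ?_
    gcongr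
    push_cast
    rcases min_choice |(m : ℝ) - n| |(m : ℝ) + n - k| with h | h
    · rw [hμ, h]
      have : 0 ≤ (1 + |(m : ℝ) + n - k|) ^ (-(1 + δ)) := by positivity
      linarith
    · rw [hμ, h]
      have : 0 ≤ (1 + |(m : ℝ) - n|) ^ (-(1 + δ)) := by positivity
      linarith
  have hsum := summable_one_add_abs_int_rpow (b := 1 + δ) (by linarith)
  set T := ∑' n : ℤ, (1 + |(n : ℝ)|) ^ (-(1 + δ)) with hT
  have hT0 : 0 < T := hsum.tsum_pos (fun n => by positivity) 0 (by positivity)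
  have hshift : ∀ (c : ℤ) (F : Finset ℤ), ∑ m ∈ F, (1 + |((m + c : ℤ) : ℝ)|) ^ (-(1 + δ)) ≤ T := by
    intro c F
    have := hsum.sum_le_tsum (F.map (Equiv.addRight c).toEmbedding) (fun n _ => by positivity)
    rw [Finset.sum_map] at this
    exact this
  refine ⟨B * (T + T), by positivity, fun k n F => (Finset.sum_le_sum fun m _ => key k n m).trans ?_⟩
  rw [← Finset.mul_sum, Finset.sum_add_distrib]
  gcongr
  · simpa [sub_eq_add_neg] using hshift (-n) F
  · simpa [sub_eq_add_neg, add_assoc] using hshift (n - k) F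

lemma integral_exp_int_mul (n : ℤ) :
    ∫ x in (0 : ℝ)..(2 * π), Complex.exp (Complex.I * ((n * x : ℝ) : ℂ)) =
      if n = 0 then ((2 * π : ℝ) : ℂ) else 0 := by
  split_ifs with h
  · simp [h]
  · have hc : Complex.I * (n : ℂ) ≠ 0 := mul_ne_zero Complex.I_ne_zero (by exact_mod_cast h)
    have := integral_exp_mul_complex (a := 0) (b := 2 * π) hc
    have h2 : Complex.exp (Complex.I * n * ((2 * π : ℝ) : ℂ)) = 1 := by
      rw [← Complex.exp_int_mul_two_pi_mul_I n]
      congr 1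
      push_cast
      ring
    rw [h2] at this
    simp only [Complex.ofReal_zero, mul_zero, Complex.exp_zero, sub_self, zero_div] at this
    rw [← this]
    congr 1
    ext x
    push_cast
    ring_nf

lemma exp_neg_abs_mul_eqOn_Ioi (ξ : ℝ) :
    Set.EqOn (fun t : ℝ => ((exp (-|t|) : ℝ) : ℂ) * Complex.exp (Complex.I * ((t * ξ : ℝ) : ℂ)))
      (fun t : ℝ => Complex.exp ((-1 + Complex.I * ξ) * t)) (Set.Ioi 0) := by
  intro t ht
  simp only
  rw [abs_of_pos ht, Complex.ofReal_exp, ← Complex.exp_add]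
  push_cast
  ring_nf

lemma exp_neg_abs_mul_eqOn_Iic (ξ : ℝ) :
    Set.EqOn (fun t : ℝ => ((exp (-|t|) : ℝ) : ℂ) * Complex.exp (Complex.I * ((t * ξ : ℝ) : ℂ)))
      (fun t : ℝ => Complex.exp ((1 + Complex.I * ξ) * t)) (Set.Iic 0) := by
  intro t ht
  simp only
  rw [abs_of_nonpos ht, Complex.ofReal_exp, ← Complex.exp_add]
  push_cast
  ring_nf

lemma integrable_exp_neg_abs_mul (ξ : ℝ) :
    Integrable fun t : ℝ =>
      ((exp (-|t|) : ℝ) : ℂ) * Complex.exp (Complex.I * ((t * ξ : ℝ) : ℂ)) := by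
  rw [← integrableOn_univ, ← Set.Iic_union_Ioi (a := (0 : ℝ))]
  refine IntegrableOn.union ?_ ?_
  · rw [integrableOn_congr_fun (exp_neg_abs_mul_eqOn_Iic ξ) measurableSet_Iic]
    exact integrableOn_exp_mul_complex_Iic (by simp) 0
  · rw [integrableOn_congr_fun (exp_neg_abs_mul_eqOn_Ioi ξ) measurableSet_Ioi]
    exact integrableOn_exp_mul_complex_Ioi (by simp) 0

lemma integral_exp_neg_abs_mul (ξ : ℝ) :
    ∫ t : ℝ, ((exp (-|t|) : ℝ) : ℂ) * Complex.exp (Complex.I * ((t * ξ : ℝ) : ℂ)) =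
      ((2 * (1 + ξ ^ 2)⁻¹ : ℝ) : ℂ) := by
  rw [← intervalIntegral.integral_Iic_add_Ioi (b := 0) (integrable_exp_neg_abs_mul ξ).integrableOn
    (integrable_exp_neg_abs_mul ξ).integrableOn,
    setIntegral_congr_fun measurableSet_Iic (exp_neg_abs_mul_eqOn_Iic ξ),
    setIntegral_congr_fun measurableSet_Ioi (exp_neg_abs_mul_eqOn_Ioi ξ),
    integral_exp_mul_complex_Ioi (by simp), integral_exp_mul_complex_Iic (by simp)]
  have h1 : (1 + Complex.I * ξ) ≠ 0 := fun h => by simpa using congrArg Complex.re h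
  have h2 : (-1 + Complex.I * ξ) ≠ 0 := fun h => by simpa using congrArg Complex.re h
  have h3 : (1 + (ξ : ℂ) ^ 2) ≠ 0 := by
    have : (1 + ξ ^ 2 : ℝ) ≠ 0 := by positivity
    exact_mod_cast this
  push_cast
  simp only [mul_zero, Complex.exp_zero]
  field_simp
  linear_combination (-2 * ξ ^ 2) * Complex.I_sq

lemma ofReal_norm_sum_sq {ι : Type*} (P : Finset ι) (z : ι → ℂ) :
    ((‖∑ p ∈ P, z p‖ ^ 2 : ℝ) : ℂ) = ∑ p ∈ P, ∑ q ∈ P, z p * starRingEnd ℂ (z q) := by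
  push_cast
  rw [← Complex.mul_conj', map_sum, Finset.sum_mul_sum]

lemma exp_mul_conj_exp (a b : ℝ) :
    Complex.exp (Complex.I * (a : ℂ)) * starRingEnd ℂ (Complex.exp (Complex.I * (b : ℂ))) =
      Complex.exp (Complex.I * ((a - b : ℝ) : ℂ)) := by
  rw [← Complex.exp_conj, ← Complex.exp_add]
  congr 1
  simp
  ring

lemma integral_norm_trig_sum_sq {ι : Type*} (P : Finset ι) (c : ι → ℂ) (σ : ι → ℤ) :
    ((∫ x in (0 : ℝ)..(2 * π),
        ‖∑ p ∈ P, c p * Complex.exp (Complex.I * ((σ p * x : ℝ) : ℂ))‖ ^ 2 : ℝ) : ℂ) =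
      ∑ p ∈ P, ∑ q ∈ P, if σ p = σ q then ((2 * π : ℝ) : ℂ) * (c p * starRingEnd ℂ (c q)) else 0 := by
  rw [← intervalIntegral.integral_ofReal]
  simp_rw [ofReal_norm_sum_sq]
  rw [intervalIntegral.integral_finsetSum
    (fun p _ => Continuous.intervalIntegrable (by fun_prop) _ _)]
  refine Finset.sum_congr rfl fun p _ => ?_
  rw [intervalIntegral.integral_finsetSum
    (fun q _ => Continuous.intervalIntegrable (by fun_prop) _ _)]
  refine Finset.sum_congr rfl fun q _ => ?_
  have h : ∀ x : ℝ, c p * Complex.exp (Complex.I * ((σ p * x : ℝ) : ℂ)) *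
      starRingEnd ℂ (c q * Complex.exp (Complex.I * ((σ q * x : ℝ) : ℂ))) =
      c p * starRingEnd ℂ (c q) * Complex.exp (Complex.I * (((σ p - σ q : ℤ) * x : ℝ) : ℂ)) := by
    intro x
    rw [map_mul, mul_mul_mul_comm, exp_mul_conj_exp]
    push_cast
    ring_nf
  simp_rw [h]
  rw [intervalIntegral.integral_const_mul, integral_exp_int_mul]
  simp only [sub_eq_zero]
  split_ifs
  · ring
  · simp

/-- An `L²` bound for space-time exponential sums: the cutoff to `t ∈ [0, 2π]` is dominated by
`exp (-|t|)`, whose Fourier transform is the Poisson kernel. -/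
lemma integral_integral_norm_exp_sum_sq_le {ι : Type*} (P : Finset ι) (b : ι → ℂ) (ψ : ι → ℝ)
    (σ : ι → ℤ) :
    ∫ t in (0 : ℝ)..(2 * π), ∫ x in (0 : ℝ)..(2 * π),
        ‖∑ p ∈ P, b p * Complex.exp (Complex.I * ((t * ψ p + σ p * x : ℝ) : ℂ))‖ ^ 2 ≤
      4 * π * exp (2 * π) * ∑ p ∈ P, ∑ q ∈ P,
        if σ p = σ q then ‖b p‖ * ‖b q‖ * (1 + (ψ p - ψ q) ^ 2)⁻¹ else 0 := by
  set G : ℝ → ℝ := fun t => ∫ x in (0 : ℝ)..(2 * π),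
    ‖∑ p ∈ P, b p * Complex.exp (Complex.I * ((t * ψ p + σ p * x : ℝ) : ℂ))‖ ^ 2 with hG
  have hGc : ∀ t, ((exp (-|t|) * G t : ℝ) : ℂ) = ∑ p ∈ P, ∑ q ∈ P, if σ p = σ q then
      ((2 * π : ℝ) : ℂ) * (b p * starRingEnd ℂ (b q)) *
        (((exp (-|t|) : ℝ) : ℂ) * Complex.exp (Complex.I * ((t * (ψ p - ψ q) : ℝ) : ℂ)))
      else 0 := by
    intro t
    have h := integral_norm_trig_sum_sq P
      (fun p => b p * Complex.exp (Complex.I * ((t * ψ p : ℝ) : ℂ))) σ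
    simp only [mul_assoc, ← Complex.exp_add, ← mul_add, ← Complex.ofReal_add] at h
    rw [Complex.ofReal_mul, hG]
    simp only
    rw [h, Finset.mul_sum]
    refine Finset.sum_congr rfl fun p _ => ?_
    rw [Finset.mul_sum]
    refine Finset.sum_congr rfl fun q _ => ?_
    split_ifs
    · rw [mul_sub t, ← exp_mul_conj_exp, map_mul]
      ring
    · simp
  have hGi : Integrable fun t => ((exp (-|t|) * G t : ℝ) : ℂ) := by
    simp_rw [hGc]
    refine integrable_finsetSum _ fun p _ => integrable_finsetSum _ fun q _ => ?_
    split_ifs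
    · exact (integrable_exp_neg_abs_mul _).const_mul _
    · exact integrable_zero _ _ _
  have hG0 : ∀ t, 0 ≤ G t := fun t =>
    intervalIntegral.integral_nonneg (by positivity) fun x _ => by positivity
  have hGr : Integrable fun t => exp (-|t|) * G t := by
    exact hGi.re
  have hcont : Continuous G := by
    apply intervalIntegral.continuous_parametric_intervalIntegral_of_continuous'
    fun_prop
  have h1 : ∫ t in (0 : ℝ)..(2 * π), G t ≤ exp (2 * π) * ∫ t, exp (-|t|) * G t := by
    rw [← integral_const_mul]
    refine le_trans ?_ (setIntegral_le_integral (s := Set.Ioc 0 (2 * π)) (hGr.const_mul _)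
      (Filter.Eventually.of_forall fun t =>
        mul_nonneg (exp_pos _).le (mul_nonneg (exp_pos _).le (hG0 t))))
    rw [intervalIntegral.integral_of_le (by positivity)]
    refine setIntegral_mono_on (hcont.integrableOn_Ioc) (hGr.const_mul _).integrableOn
      measurableSet_Ioc fun t ht => ?_
    rw [← mul_assoc, ← exp_add, abs_of_pos ht.1]
    exact le_mul_of_one_le_left (hG0 t) (one_le_exp (by linarith [ht.2]))
  have h2 : ((∫ t, exp (-|t|) * G t : ℝ) : ℂ) = ∑ p ∈ P, ∑ q ∈ P, if σ p = σ q then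
      ((2 * π : ℝ) : ℂ) * (b p * starRingEnd ℂ (b q)) * ((2 * (1 + (ψ p - ψ q) ^ 2)⁻¹ : ℝ) : ℂ)
      else 0 := by
    have hi : ∀ p q, Integrable fun t : ℝ => if σ p = σ q then
      ((2 * π : ℝ) : ℂ) * (b p * starRingEnd ℂ (b q)) *
        (((exp (-|t|) : ℝ) : ℂ) * Complex.exp (Complex.I * ((t * (ψ p - ψ q) : ℝ) : ℂ)))
      else 0 := by
      intro p q
      split_ifs
      · exact (integrable_exp_neg_abs_mul _).const_mul _
      · exact integrable_zero _ _ _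
    rw [← integral_complex_ofReal]
    simp_rw [hGc]
    rw [integral_finsetSum _ fun p _ => integrable_finsetSum _ fun q _ => hi p q]
    refine Finset.sum_congr rfl fun p _ => ?_
    rw [integral_finsetSum _ fun q _ => hi p q]
    refine Finset.sum_congr rfl fun q _ => ?_
    split_ifs
    · rw [integral_const_mul, integral_exp_neg_abs_mul]
    · simp
  have h3 : ∫ t, exp (-|t|) * G t ≤ 4 * π * ∑ p ∈ P, ∑ q ∈ P,
        if σ p = σ q then ‖b p‖ * ‖b q‖ * (1 + (ψ p - ψ q) ^ 2)⁻¹ else 0 := by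
    refine (le_abs_self _).trans ?_
    rw [← Real.norm_eq_abs, ← Complex.norm_real, h2, Finset.mul_sum]
    refine norm_sum_le_of_le _ fun p _ => ?_
    rw [Finset.mul_sum]
    refine norm_sum_le_of_le _ fun q _ => ?_
    split_ifs
    · rw [norm_mul, norm_mul, norm_mul, Complex.norm_real, Complex.norm_real, RCLike.norm_conj,
        Real.norm_eq_abs, Real.norm_eq_abs]
      rw [abs_of_pos (by positivity : 0 < 2 * π),
        abs_of_pos (by positivity : 0 < 2 * (1 + (ψ p - ψ q) ^ 2)⁻¹)]
      apply le_of_eq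
      ring
    · simp
  calc _ ≤ _ := h1
    _ ≤ _ := mul_le_mul_of_nonneg_left h3 (exp_pos _).le
    _ = _ := by ring

/-- A weighted Schur test for a symmetric nonnegative kernel. -/
lemma sum_sum_mul_kernel_le {ι : Type*} (P : Finset ι) (x w : ι → ℝ) (K : ι → ι → ℝ) {C : ℝ}
    (hw : ∀ p, 0 < w p) (hK : ∀ p q, 0 ≤ K p q) (hKs : ∀ p q, K p q = K q p)
    (hC : ∀ p ∈ P, ∑ q ∈ P, K p q * (w q)⁻¹ ≤ C) :
    ∑ p ∈ P, ∑ q ∈ P, x p * x q * K p q ≤ C * ∑ p ∈ P, x p ^ 2 * w p := by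
  have h1 : ∑ p ∈ P, ∑ q ∈ P, x p ^ 2 * w p * (K p q * (w q)⁻¹) ≤
      C * ∑ p ∈ P, x p ^ 2 * w p := by
    rw [Finset.mul_sum]
    refine Finset.sum_le_sum fun p hp => ?_
    rw [← Finset.mul_sum, mul_comm C]
    exact mul_le_mul_of_nonneg_left (hC p hp) (mul_nonneg (sq_nonneg _) (hw p).le)
  have h2 : ∑ p ∈ P, ∑ q ∈ P, x q ^ 2 * w q * (K q p * (w p)⁻¹) ≤
      C * ∑ p ∈ P, x p ^ 2 * w p := by
    rw [Finset.sum_comm]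
    exact h1
  have h3 : ∀ p q, x p * x q * K p q ≤
      (x p ^ 2 * w p * (K p q * (w q)⁻¹) + x q ^ 2 * w q * (K q p * (w p)⁻¹)) / 2 := by
    intro p q
    have hp := hw p
    have hq := hw q
    have h4 : x p * x q ≤ (x p ^ 2 * w p * (w q)⁻¹ + x q ^ 2 * w q * (w p)⁻¹) / 2 := by
      have h5 : (x p ^ 2 * w p * (w q)⁻¹ + x q ^ 2 * w q * (w p)⁻¹) / 2 - x p * x q =
          (x p * w p - x q * w q) ^ 2 / (2 * (w p * w q)) := by
        field_simp
        ring
      have h6 : 0 ≤ (x p * w p - x q * w q) ^ 2 / (2 * (w p * w q)) := by positivity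
      linarith
    rw [hKs q p]
    linarith [mul_le_mul_of_nonneg_right h4 (hK p q)]
  calc _ ≤ ∑ p ∈ P, ∑ q ∈ P,
        (x p ^ 2 * w p * (K p q * (w q)⁻¹) + x q ^ 2 * w q * (K q p * (w p)⁻¹)) / 2 :=
        Finset.sum_le_sum fun p _ => Finset.sum_le_sum fun q _ => h3 p q
    _ ≤ _ := by
      simp_rw [← Finset.sum_div, Finset.sum_add_distrib]
      linarith

/-- The partial sum over the frequencies in `A` of the series defining `fracProp`. -/
noncomputable def fracPropPartial (α : ℝ) (a : ℤ → ℂ) (A : Finset ℤ) (t x : ℝ) : ℂ :=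
  ∑ n ∈ A, a n * Complex.exp (Complex.I * ((t * (|n| : ℝ) ^ (2 * α) + (n : ℝ) * x : ℝ) : ℂ))

lemma norm_fracPropPartial_pow_four (α : ℝ) (a : ℤ → ℂ) (A : Finset ℤ) (t x : ℝ) :
    ‖fracPropPartial α a A t x‖ ^ 4 = ‖∑ p ∈ A ×ˢ A, a p.1 * a p.2 *
      Complex.exp (Complex.I *
        ((t * (|(p.1 : ℝ)| ^ (2 * α) + |(p.2 : ℝ)| ^ (2 * α)) +
          (p.1 + p.2 : ℤ) * x : ℝ) : ℂ))‖ ^ 2 := by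
  rw [show (4 : ℕ) = 2 * 2 from rfl, pow_mul, ← norm_pow, sq (fracPropPartial α a A t x),
    fracPropPartial, Finset.sum_mul_sum, ← Finset.sum_product']
  congr 2
  refine Finset.sum_congr rfl fun p _ => ?_
  rw [mul_mul_mul_comm, ← Complex.exp_add]
  push_cast
  ring_nf

lemma fracPropPartial_estimate {α s : ℝ} (hα : 1 / 2 < α) (hα1 : α < 1) (hs : (1 - α) / 4 < s) :
    ∃ C > 0, ∀ (a : ℤ → ℂ) (A : Finset ℤ),
      ∫ t in (0 : ℝ)..(2 * π), ∫ x in (0 : ℝ)..(2 * π), ‖fracPropPartial α a A t x‖ ^ 4 ≤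
        C * (∑ n ∈ A, jb n ^ (2 * s) * ‖a n‖ ^ 2) ^ 2 := by
  obtain ⟨C, hC, H⟩ := sum_resonance_le hα hα1 hs
  refine ⟨4 * π * exp (2 * π) * C, by positivity, fun a A => ?_⟩
  have hjb : ∀ n, 0 < jb n := fun n => one_pos.trans_le (one_le_jb n)
  simp_rw [norm_fracPropPartial_pow_four]
  refine (integral_integral_norm_exp_sum_sq_le (A ×ˢ A) (fun p => a p.1 * a p.2)
    (fun p => |(p.1 : ℝ)| ^ (2 * α) + |(p.2 : ℝ)| ^ (2 * α)) (fun p => p.1 + p.2)).trans ?_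
  rw [mul_assoc _ C]
  refine mul_le_mul_of_nonneg_left ?_ (by positivity)
  set ψ : ℤ × ℤ → ℝ := fun p => |(p.1 : ℝ)| ^ (2 * α) + |(p.2 : ℝ)| ^ (2 * α) with hψ
  have hS := sum_sum_mul_kernel_le (A ×ˢ A) (fun p => ‖a p.1 * a p.2‖)
    (fun p => jb p.1 ^ (2 * s) * jb p.2 ^ (2 * s))
    (fun p q => if p.1 + p.2 = q.1 + q.2 then (1 + (ψ p - ψ q) ^ 2)⁻¹ else 0) (C := C)
    (fun p => mul_pos (rpow_pos_of_pos (hjb _) _) (rpow_pos_of_pos (hjb _) _))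
    (fun p q => by split_ifs <;> positivity)
    (fun p q => by
      rw [show ψ p - ψ q = -(ψ q - ψ p) by ring, neg_sq]
      simp only [eq_comm])
    (by
      intro p _
      refine le_trans ?_ (H (p.1 + p.2) p.1 A)
      rw [Finset.sum_product]
      refine Finset.sum_le_sum fun m _ => ?_
      have h1 : ∀ l : ℤ, p.1 + p.2 = m + l ↔ l = p.1 + p.2 - m := fun l => by omega
      simp only [h1, ite_mul, zero_mul]
      rw [Finset.sum_ite_eq']
      have h2 : ψ p = pairPhase α ((p.1 + p.2 : ℤ) : ℝ) p.1 := by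
        simp [hψ, pairPhase]
      have h3 : ψ (m, p.1 + p.2 - m) = pairPhase α ((p.1 + p.2 : ℤ) : ℝ) m := by
        simp [hψ, pairPhase]
      split_ifs
      · rw [h2, h3]
      · have := hjb m
        have := hjb (p.1 + p.2 - m)
        positivity)
  refine le_trans (le_of_eq ?_) (hS.trans (le_of_eq ?_))
  · refine Finset.sum_congr rfl fun p _ => Finset.sum_congr rfl fun q _ => ?_
    simp only [mul_ite, mul_zero, hψ]
  · rw [sq, Finset.sum_mul_sum, ← Finset.sum_product']
    congr 1
    refine Finset.sum_congr rfl fun p _ => ?_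
    rw [norm_mul]
    ring

lemma tendsto_integral_fracPropPartial (α : ℝ) {a : ℤ → ℂ} (ha : Summable fun n => ‖a n‖) :
    Filter.Tendsto
      (fun A => ∫ t in (0 : ℝ)..(2 * π), ∫ x in (0 : ℝ)..(2 * π), ‖fracPropPartial α a A t x‖ ^ 4)
      Filter.atTop
      (nhds (∫ t in (0 : ℝ)..(2 * π), ∫ x in (0 : ℝ)..(2 * π), ‖fracProp α a t x‖ ^ 4)) := by
  have hcont : ∀ A, Continuous (Function.uncurry fun t x => ‖fracPropPartial α a A t x‖ ^ 4) := by
    intro A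
    unfold fracPropPartial
    fun_prop
  have hbound : ∀ A t x, ‖fracPropPartial α a A t x‖ ^ 4 ≤ (∑' n, ‖a n‖) ^ 4 := by
    intro A t x
    refine pow_le_pow_left₀ (norm_nonneg _) ?_ 4
    refine le_trans ?_ (ha.sum_le_tsum A fun n _ => norm_nonneg _)
    refine norm_sum_le_of_le _ fun n _ => ?_
    rw [norm_mul, Complex.norm_exp_I_mul_ofReal, mul_one]
  have hlim : ∀ t x, Filter.Tendsto (fun A => ‖fracPropPartial α a A t x‖ ^ 4) Filter.atTop
      (nhds (‖fracProp α a t x‖ ^ 4)) := by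
    intro t x
    refine (Filter.Tendsto.norm ?_).pow 4
    refine (Summable.of_norm ?_).hasSum
    simpa only [norm_mul, Complex.norm_exp_I_mul_ofReal, mul_one] using ha
  refine intervalIntegral.tendsto_integral_filter_of_dominated_convergence
    (fun _ => (∑' n, ‖a n‖) ^ 4 * (2 * π)) ?_ ?_ intervalIntegrable_const ?_
  · exact Filter.Eventually.of_forall fun A =>
      (intervalIntegral.continuous_parametric_intervalIntegral_of_continuous' (hcont A) _
        _).aestronglyMeasurable
  · refine Filter.Eventually.of_forall fun A => Filter.Eventually.of_forall fun t _ => ?_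
    refine (intervalIntegral.norm_integral_le_of_norm_le_const (C := (∑' n, ‖a n‖) ^ 4)
      fun x _ => ?_).trans (le_of_eq ?_)
    · rw [norm_pow, norm_norm]
      exact hbound A t x
    · rw [sub_zero, abs_of_pos (by positivity)]
  · refine Filter.Eventually.of_forall fun t _ => ?_
    refine intervalIntegral.tendsto_integral_filter_of_dominated_convergence
      (fun _ => (∑' n, ‖a n‖) ^ 4) ?_ ?_ intervalIntegrable_const ?_
    · exact Filter.Eventually.of_forall fun A =>
        ((hcont A).comp (Continuous.prodMk_right t)).aestronglyMeasurable
    · refine Filter.Eventually.of_forall fun A => Filter.Eventually.of_forall fun x _ => ?_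
      rw [norm_pow, norm_norm]
      exact hbound A t x
    · exact Filter.Eventually.of_forall fun x _ => hlim t x

/-- the `L⁴_{t,x}` Strichartz estimate
`‖e^{it(-Δ)^α} f‖_{L⁴(𝕋×𝕋)} ≲ ‖f‖_{H^s}` for `s > (1-α)/4`, stated with fourth powers. -/
theorem stmt_11 (α s : ℝ) (hα : 1 / 2 < α) (hα1 : α < 1) (hs : (1 - α) / 4 < s) :
    ∃ C > 0, ∀ a : ℤ → ℂ,
      Summable (fun n : ℤ => jb n ^ (2 * s) * ‖a n‖ ^ 2) →
      (∫ t in (0 : ℝ)..(2 * π), ∫ x in (0 : ℝ)..(2 * π), ‖fracProp α a t x‖ ^ 4)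
        ≤ C * (∑' n : ℤ, jb n ^ (2 * s) * ‖a n‖ ^ 2) ^ 2 := by
  obtain ⟨C, hC, H⟩ := fracPropPartial_estimate hα hα1 hs
  refine ⟨C, hC, fun a hsum => ?_⟩
  have hjb : ∀ n : ℤ, 0 ≤ jb n ^ (2 * s) * ‖a n‖ ^ 2 := fun n =>
    mul_nonneg (rpow_nonneg (zero_le_one.trans (one_le_jb n)) _) (sq_nonneg _)
  by_cases ha : Summable fun n => ‖a n‖
  · refine le_of_tendsto (tendsto_integral_fracPropPartial α ha)
      (Filter.Eventually.of_forall fun A => (H a A).trans ?_)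
    gcongr
    · exact Finset.sum_nonneg fun n _ => hjb n
    · exact hsum.sum_le_tsum A fun n _ => hjb n
  · have h0 : ∀ t x, fracProp α a t x = 0 := by
      intro t x
      refine tsum_eq_zero_of_not_summable fun h => ha ?_
      simpa only [norm_mul, Complex.norm_exp_I_mul_ofReal, mul_one] using h.norm
    simp only [h0, norm_zero, ne_eq, OfNat.ofNat_ne_zero, not_false_eq_true, zero_pow,
      intervalIntegral.integral_zero]
    positivity
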